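/- The additive composition products of the Drinfeld–Kohno operad are Lie algebra morphisms: the map ∘_i : p(k) ⊕ p(l) → p(k+l−1) defined on generators by the insertion formulas (t_{ab} ∘_i 0 equal to t_{a+l−1,b+l−1}, t_{a,b+l−1}+⋯+t_{a+l−1,b+l−1}, t_{a,b+l−1}, t_{ab}+⋯+t_{a,b+l−1} (sum over the inserted block), or t_{ab}, according to the position of i relative to a < b; and 0 ∘_i t_{cd} = t_{c+i−1,d+i−1}) is well defined, i.e. it respects the defining relations of p(k) and p(l) and the images of p(k) and p(l) commute in p(k+l−1). -/

import Mathlib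

open FreeLieAlgebra

/-- The defining relations of the Drinfeld–Kohno Lie algebra `p(r)`. -/
def dkRels (r : ℕ) : Set (FreeLieAlgebra ℚ (Fin r × Fin r)) :=
  {x | (∃ i j : Fin r, x = of ℚ (i, j) - of ℚ (j, i)) ∨
       (∃ i : Fin r, x = of ℚ (i, i)) ∨
       (∃ i j k l : Fin r, i ≠ j ∧ i ≠ k ∧ i ≠ l ∧ j ≠ k ∧ j ≠ l ∧ k ≠ l ∧
         x = ⁅of ℚ (i, j), of ℚ (k, l)⁆) ∨
       (∃ i j k : Fin r, i ≠ j ∧ i ≠ k ∧ j ≠ k ∧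
         x = ⁅of ℚ (i, j), of ℚ (i, k) + of ℚ (j, k)⁆)}

/-- The Lie ideal generated by the Drinfeld–Kohno relations. -/
noncomputable def dkIdeal (r : ℕ) : LieIdeal ℚ (FreeLieAlgebra ℚ (Fin r × Fin r)) :=
  LieSubmodule.lieSpan ℚ _ (dkRels r)

/-- The Drinfeld–Kohno Lie algebra `p(r)`. -/
abbrev DrinfeldKohno (r : ℕ) := FreeLieAlgebra ℚ (Fin r × Fin r) ⧸ dkIdeal r

/-- The generator `t_{ij}` of the Drinfeld–Kohno Lie algebra. -/
noncomputable def DrinfeldKohno.t {r : ℕ} (i j : Fin r) : DrinfeldKohno r :=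
  LieSubmodule.Quotient.mk (N := dkIdeal r) (of ℚ (i, j))

namespace DKaux

open DrinfeldKohno

/-- Lift from the quotient. -/
theorem exists_lift {r : ℕ} {L : Type*} [LieRing L] [LieAlgebra ℚ L] (f : Fin r × Fin r → L)
    (hf : ∀ x ∈ dkRels r, FreeLieAlgebra.lift ℚ f x = 0) :
    ∃ φ : DrinfeldKohno r →ₗ⁅ℚ⁆ L, ∀ a b, φ (t a b) = f (a, b) := by
  set F := FreeLieAlgebra.lift ℚ f with hF
  have hle : dkIdeal r ≤ F.ker := by
    rw [dkIdeal, LieSubmodule.lieSpan_le]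
    intro x hx
    exact LieHom.mem_ker.2 (hf x hx)
  have hle' : (dkIdeal r).toSubmodule ≤ LinearMap.ker (F : _ →ₗ[ℚ] L) := by
    intro x hx
    exact LieHom.mem_ker.1 (hle hx)
  refine ⟨{ (Submodule.liftQ (dkIdeal r).toSubmodule (F : _ →ₗ[ℚ] L) hle' :
      DrinfeldKohno r →ₗ[ℚ] L) with
    map_lie' := ?_ }, ?_⟩
  · intro x y
    induction x, y using Quotient.inductionOn₂' with | _ x y
    exact F.map_lie x y
  · intro a b
    exact FreeLieAlgebra.lift_of_apply f (a, b)

theorem t_symm {r : ℕ} (i j : Fin r) : (t i j : DrinfeldKohno r) = t j i := by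
  rw [← sub_eq_zero]
  exact (LieSubmodule.Quotient.mk_eq_zero' (N := dkIdeal r)).2
    (LieSubmodule.subset_lieSpan (Or.inl ⟨i, j, rfl⟩))

theorem t_self {r : ℕ} (i : Fin r) : (t i i : DrinfeldKohno r) = 0 :=
  (LieSubmodule.Quotient.mk_eq_zero' (N := dkIdeal r)).2
    (LieSubmodule.subset_lieSpan (Or.inr (Or.inl ⟨i, rfl⟩)))

theorem t_comm {r : ℕ} (i j k l : Fin r) (h1 : i ≠ k) (h2 : i ≠ l) (h3 : j ≠ k) (h4 : j ≠ l) :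
    ⁅(t i j : DrinfeldKohno r), (t k l : DrinfeldKohno r)⁆ = 0 := by
  by_cases hij : i = j
  · subst hij; rw [t_self, zero_lie]
  by_cases hkl : k = l
  · subst hkl; rw [t_self, lie_zero]
  exact (LieSubmodule.Quotient.mk_eq_zero' (N := dkIdeal r)).2
    (LieSubmodule.subset_lieSpan (Or.inr (Or.inr (Or.inl
      ⟨i, j, k, l, hij, h1, h2, h3, h4, hkl, rfl⟩))))

theorem t_four {r : ℕ} (i j k : Fin r) (h2 : i ≠ k) (h3 : j ≠ k) :
    ⁅(t i j : DrinfeldKohno r), (t i k + t j k : DrinfeldKohno r)⁆ = 0 := by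
  by_cases hij : i = j
  · subst hij; rw [t_self, zero_lie]
  exact (LieSubmodule.Quotient.mk_eq_zero' (N := dkIdeal r)).2
    (LieSubmodule.subset_lieSpan (Or.inr (Or.inr (Or.inr
      ⟨i, j, k, hij, h2, h3, rfl⟩))))

/-- `t_{xy}` commutes with the sum of `t_{uv}` over a block of `u` containing `x` and `y`. -/
theorem t_block {r : ℕ} (A : Finset (Fin r)) (x y v : Fin r) (hx : x ∈ A) (hy : y ∈ A)
    (hv : v ∉ A) : ⁅(t x y : DrinfeldKohno r), ∑ u ∈ A, (t u v : DrinfeldKohno r)⁆ = 0 := by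
  by_cases hxy : x = y
  · subst hxy; rw [t_self, zero_lie]
  have hxv : x ≠ v := fun h => hv (h ▸ hx)
  have hyv : y ≠ v := fun h => hv (h ▸ hy)
  rw [← Finset.add_sum_erase A _ hx,
    ← Finset.add_sum_erase (A.erase x) _ (Finset.mem_erase.2 ⟨Ne.symm hxy, hy⟩), ← add_assoc,
    lie_add, t_four x y v hxv hyv, zero_add, lie_sum]
  refine Finset.sum_eq_zero fun u hu => ?_
  simp only [Finset.mem_erase] at hu
  exact t_comm _ _ _ _ (Ne.symm hu.2.1) hxv (Ne.symm hu.1) hyv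

/-- The sum of `t_{xy}` over two blocks. -/
noncomputable def S {r : ℕ} (A B : Finset (Fin r)) : DrinfeldKohno r :=
  ∑ v ∈ B, ∑ u ∈ A, t u v

theorem S_symm {r : ℕ} (A B : Finset (Fin r)) : S A B = S B A := by
  unfold S
  rw [Finset.sum_comm]
  simp_rw [t_symm]

theorem t_S_block {r : ℕ} (A B : Finset (Fin r)) (x y : Fin r) (hx : x ∈ A) (hy : y ∈ A)
    (h : Disjoint A B) : ⁅(t x y : DrinfeldKohno r), S A B⁆ = 0 := by
  unfold S
  rw [lie_sum]
  exact Finset.sum_eq_zero fun v hv =>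
    t_block A x y v hx hy fun h' => Finset.disjoint_left.1 h h' hv

theorem t_S_disj {r : ℕ} (A B : Finset (Fin r)) (x y : Fin r) (hxA : x ∉ A) (hxB : x ∉ B)
    (hyA : y ∉ A) (hyB : y ∉ B) : ⁅(t x y : DrinfeldKohno r), S A B⁆ = 0 := by
  unfold S
  simp_rw [lie_sum]
  refine Finset.sum_eq_zero fun v hv => Finset.sum_eq_zero fun u hu => ?_
  refine t_comm _ _ _ _ ?_ ?_ ?_ ?_ <;> rintro rfl <;> contradiction

theorem S_lie {r : ℕ} (A B : Finset (Fin r)) (z : DrinfeldKohno r)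
    (h : ∀ x ∈ A, ∀ y ∈ B, ⁅(t x y : DrinfeldKohno r), z⁆ = 0) : ⁅S A B, z⁆ = 0 := by
  unfold S
  simp_rw [sum_lie]
  exact Finset.sum_eq_zero fun v hv => Finset.sum_eq_zero fun u hu => h u hu v hv

/-- Blocks of the strand map `pos`. -/
def F {n : ℕ} (pos : Fin n → ℕ) (a : ℕ) : Finset (Fin n) :=
  Finset.univ.filter fun x => pos x = a

theorem mem_F {n : ℕ} (pos : Fin n → ℕ) (a : ℕ) (x : Fin n) : x ∈ F pos a ↔ pos x = a := by
  simp [F]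

theorem F_disj {n : ℕ} (pos : Fin n → ℕ) {a b : ℕ} (h : a ≠ b) :
    Disjoint (F pos a) (F pos b) := by
  rw [Finset.disjoint_left]
  intro x hx hx'
  rw [mem_F] at hx hx'
  omega

theorem exists_cabling (k n : ℕ) (pos : Fin n → ℕ) :
    ∃ φ : DrinfeldKohno k →ₗ⁅ℚ⁆ DrinfeldKohno n, ∀ a b : Fin k,
      φ (t a b) = if a = b then 0 else S (F pos a) (F pos b) := by
  refine exists_lift (fun p => if p.1 = p.2 then 0 else S (F pos p.1) (F pos p.2)) ?_
  have hne : ∀ {a b : Fin k}, a ≠ b → (a : ℕ) ≠ b := fun h h' => h (Fin.ext h')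
  rintro x (⟨i, j, rfl⟩ | ⟨i, rfl⟩ | ⟨i, j, a, b, h1, h2, h3, h4, h5, h6, rfl⟩ |
    ⟨i, j, a, h1, h2, h3, rfl⟩)
  · simp only [map_sub, FreeLieAlgebra.lift_of_apply]
    rw [S_symm]
    simp [eq_comm]
  · simp [FreeLieAlgebra.lift_of_apply]
  · simp only [LieHom.map_lie, FreeLieAlgebra.lift_of_apply, if_neg h1, if_neg h6]
    refine S_lie _ _ _ fun x hx y hy => ?_
    rw [mem_F] at hx hy
    have := hne h2
    have := hne h3
    have := hne h4
    have := hne h5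
    refine t_S_disj _ _ _ _ ?_ ?_ ?_ ?_ <;> rw [mem_F] <;> omega
  · simp only [LieHom.map_lie, map_add, FreeLieAlgebra.lift_of_apply, if_neg h1, if_neg h2,
      if_neg h3]
    have hU : S (F pos i) (F pos a) + S (F pos j) (F pos a)
        = S (F pos i ∪ F pos j) (F pos a) := by
      unfold S
      rw [← Finset.sum_add_distrib]
      exact Finset.sum_congr rfl fun v _ => (Finset.sum_union (F_disj pos (hne h1))).symm
    rw [hU]
    refine S_lie _ _ _ fun x hx y hy => ?_
    exact t_S_block _ _ _ _ (Finset.mem_union_left _ hx) (Finset.mem_union_right _ hy)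
      (Finset.disjoint_union_left.2 ⟨F_disj pos (hne h2), F_disj pos (hne h3)⟩)

theorem exists_incl (l n : ℕ) (g : Fin l → Fin n) (hg : Function.Injective g) :
    ∃ φ : DrinfeldKohno l →ₗ⁅ℚ⁆ DrinfeldKohno n, ∀ a b : Fin l,
      φ (t a b) = t (g a) (g b) := by
  refine exists_lift (fun p => t (g p.1) (g p.2)) ?_
  rintro x (⟨i, j, rfl⟩ | ⟨i, rfl⟩ | ⟨i, j, a, b, h1, h2, h3, h4, h5, h6, rfl⟩ |
    ⟨i, j, a, h1, h2, h3, rfl⟩)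
  · simp only [map_sub, FreeLieAlgebra.lift_of_apply]
    rw [t_symm, sub_self]
  · simp only [FreeLieAlgebra.lift_of_apply, t_self]
  · simp only [LieHom.map_lie, FreeLieAlgebra.lift_of_apply]
    exact t_comm _ _ _ _ (hg.ne h2) (hg.ne h3) (hg.ne h4) (hg.ne h5)
  · simp only [LieHom.map_lie, map_add, FreeLieAlgebra.lift_of_apply]
    exact t_four _ _ _ (hg.ne h2) (hg.ne h3)

/-- The generators generate. -/
theorem mem_of_t {r : ℕ} (K : LieSubalgebra ℚ (DrinfeldKohno r)) (h : ∀ a b, t a b ∈ K)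
    (x : DrinfeldKohno r) : x ∈ K := by
  let q : FreeLieAlgebra ℚ (Fin r × Fin r) →ₗ⁅ℚ⁆ DrinfeldKohno r :=
    { (dkIdeal r).toSubmodule.mkQ with map_lie' := fun {_ _} => rfl }
  let p : FreeLieAlgebra ℚ (Fin r × Fin r) →ₗ⁅ℚ⁆ K :=
    FreeLieAlgebra.lift ℚ fun p => ⟨t p.1 p.2, h p.1 p.2⟩
  have hpq : K.incl.comp p = q := by
    apply FreeLieAlgebra.hom_ext
    intro x
    simp only [LieHom.comp_apply, p, FreeLieAlgebra.lift_of_apply]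
    rfl
  induction x using Quotient.inductionOn' with | _ x
  have : q x ∈ K := by
    rw [← hpq]
    exact (p x).2
  exact this

/-- The centralizer of an element. -/
def cent {L : Type*} [LieRing L] [LieAlgebra ℚ L] (z : L) : LieSubalgebra ℚ L where
  carrier := {x | ⁅x, z⁆ = 0}
  add_mem' := by
    intro a b ha hb
    simp only [Set.mem_ofPred_eq] at *
    rw [add_lie, ha, hb, add_zero]
  zero_mem' := by simp
  smul_mem' := by
    intro c a ha
    simp only [Set.mem_ofPred_eq] at *
    rw [smul_lie, ha, smul_zero]
  lie_mem' := by
    intro a b ha hb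
    change ⁅a, z⁆ = 0 at ha
    change ⁅b, z⁆ = 0 at hb
    change ⁅⁅a, b⁆, z⁆ = 0
    rw [lie_lie, ha, hb, lie_zero, lie_zero, sub_zero]

theorem comm_of_t {k l : ℕ} {L : Type*} [LieRing L] [LieAlgebra ℚ L]
    (φ : DrinfeldKohno k →ₗ⁅ℚ⁆ L) (ψ : DrinfeldKohno l →ₗ⁅ℚ⁆ L)
    (h : ∀ a b c d, ⁅φ (t a b), ψ (t c d)⁆ = 0) (x : DrinfeldKohno k) (y : DrinfeldKohno l) :
    ⁅φ x, ψ y⁆ = 0 := by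
  have h1 : ∀ c d, ⁅φ x, ψ (t c d)⁆ = 0 := fun c d =>
    mem_of_t ((cent (ψ (t c d))).comap φ) (fun a b => h a b c d) x
  have h2 : ⁅ψ y, φ x⁆ = 0 :=
    mem_of_t ((cent (φ x)).comap ψ)
      (fun c d => by
        change ⁅ψ (t c d), φ x⁆ = 0
        rw [← lie_skew, h1, neg_zero]) y
  rw [← lie_skew, h2, neg_zero]

/-- The strand of `p(k)` that a strand of `p(k+l-1)` lies over. -/
def posn (n i l : ℕ) (x : Fin n) : ℕ :=
  if (x : ℕ) < i then x else if (x : ℕ) < i + l then i else x + 1 - l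

theorem F_lt {n i l a : ℕ} (h : a < i) (hn : a < n) : F (posn n i l) a = {⟨a, hn⟩} := by
  ext x
  rw [mem_F, Finset.mem_singleton, Fin.ext_iff, posn]
  dsimp only
  split_ifs <;> omega

theorem F_gt {n i l a : ℕ} (h : i < a) (hn : a + l - 1 < n) :
    F (posn n i l) a = {⟨a + l - 1, hn⟩} := by
  ext x
  rw [mem_F, Finset.mem_singleton, Fin.ext_iff, posn]
  dsimp only
  split_ifs <;> omega

theorem F_eq {n i l : ℕ} (g : Fin l ↪ Fin n) (hg : ∀ s, (g s : ℕ) = i + s) :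
    F (posn n i l) i = Finset.univ.map g := by
  ext x
  rw [mem_F, Finset.mem_map, posn]
  constructor
  · intro h
    have h1 : ¬ (x : ℕ) < i := by intro h'; rw [if_pos h'] at h; omega
    have h2 : (x : ℕ) < i + l := by
      by_contra h2
      rw [if_neg h1, if_neg h2] at h
      omega
    refine ⟨⟨x - i, by omega⟩, Finset.mem_univ _, Fin.ext ?_⟩
    rw [hg]
    dsimp only
    omega
  · rintro ⟨s, -, rfl⟩
    rw [hg]
    have := s.isLt
    split_ifs <;> omega

end DKaux


open DrinfeldKohno in
/-- The operadic composition `∘ᵢ : p(k) ⊕ p(l) → p(k+l−1)` of the Drinfeld–Kohno operad is a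
well-defined morphism of Lie algebras: the insertion formulas on generators respect the
defining relations of `p(k)` and `p(l)`, and the images of `p(k)` and `p(l)` commute in
`p(k+l−1)`.  (All indices are written `0`-based; the formulas are stated for `a < b`.) -/
theorem drinfeldKohno_operad_composition (k l : ℕ) (i : Fin k) :
    ∃ φ₁ : DrinfeldKohno k →ₗ⁅ℚ⁆ DrinfeldKohno (k + l - 1),
    ∃ φ₂ : DrinfeldKohno l →ₗ⁅ℚ⁆ DrinfeldKohno (k + l - 1),
      -- the left insertion `t_{ab} ∘ᵢ 0`, by cases on the position of `i` relative to `a < b`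
      (∀ a b : Fin k, ∀ hab : a < b,
        (∀ _hlt : (i : ℕ) < (a : ℕ),
          φ₁ (t a b) = t ⟨(a : ℕ) + l - 1, by have := b.isLt; have hab' : (a:ℕ) < b := hab; omega⟩
            ⟨(b : ℕ) + l - 1, by have := b.isLt; omega⟩) ∧
        (∀ _heq : (i : ℕ) = (a : ℕ),
          φ₁ (t a b) = ∑ s : Fin l,
            t ⟨(a : ℕ) + (s : ℕ), by
                have := s.isLt; have := b.isLt; have hab' : (a:ℕ) < b := hab; omega⟩
              ⟨(b : ℕ) + l - 1, by have := b.isLt; omega⟩) ∧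
        (∀ _h1 : (a : ℕ) < (i : ℕ), ∀ _h2 : (i : ℕ) < (b : ℕ),
          φ₁ (t a b) = t ⟨(a : ℕ), by have := b.isLt; have hab' : (a:ℕ) < b := hab; omega⟩
            ⟨(b : ℕ) + l - 1, by have := b.isLt; omega⟩) ∧
        (∀ _heq : (i : ℕ) = (b : ℕ),
          φ₁ (t a b) = ∑ s : Fin l,
            t ⟨(a : ℕ), by have := b.isLt; have hab' : (a:ℕ) < b := hab; omega⟩
              ⟨(b : ℕ) + (s : ℕ), by have := s.isLt; have := b.isLt; have := i.isLt; omega⟩) ∧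
        (∀ _hgt : (b : ℕ) < (i : ℕ),
          φ₁ (t a b) = t ⟨(a : ℕ), by have := i.isLt; have hab' : (a:ℕ) < b := hab; omega⟩
            ⟨(b : ℕ), by have := i.isLt; omega⟩)) ∧
      -- the right insertion `0 ∘ᵢ t_{cd}` shifts indices by `i`
      (∀ c d : Fin l, c < d →
        φ₂ (t c d) = t ⟨(c : ℕ) + (i : ℕ), by have := c.isLt; have := i.isLt; omega⟩
          ⟨(d : ℕ) + (i : ℕ), by have := d.isLt; have := i.isLt; omega⟩) ∧
      -- the images of `p(k)` and `p(l)` commute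
      (∀ (x : DrinfeldKohno k) (y : DrinfeldKohno l), ⁅φ₁ x, φ₂ y⁆ = 0) := by
  have hi := i.isLt
  let g : Fin l ↪ Fin (k + l - 1) :=
    ⟨fun s => ⟨(s : ℕ) + (i : ℕ), by have := s.isLt; omega⟩, by
      intro s s' h
      have := Fin.ext_iff.1 h
      dsimp only at this
      exact Fin.ext (by omega)⟩
  have hg : ∀ s, (g s : ℕ) = (i : ℕ) + s := fun s => Nat.add_comm _ _
  have hF := DKaux.F_eq g hg
  obtain ⟨φ₁, h₁⟩ := DKaux.exists_cabling k (k + l - 1) (DKaux.posn (k + l - 1) i l)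
  obtain ⟨φ₂, h₂⟩ := DKaux.exists_incl l (k + l - 1) g g.injective
  refine ⟨φ₁, φ₂, ?_, fun c d _ => h₂ c d, ?_⟩
  · intro a b hab
    have hab' : (a : ℕ) < b := hab
    have hb := b.isLt
    have e : φ₁ (t a b) = _ := h₁ a b
    rw [if_neg (ne_of_lt hab)] at e
    refine ⟨?_, ?_, ?_, ?_, ?_⟩
    · intro h
      rw [e, DKaux.F_gt h (by omega), DKaux.F_gt (show (i : ℕ) < b by omega) (by omega)]
      simp [DKaux.S]
    · intro h
      rw [← h, hF] at e
      rw [e, DKaux.F_gt (show (i : ℕ) < b by omega) (by omega)]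
      simp only [DKaux.S, Finset.sum_singleton, Finset.sum_map]
      refine Finset.sum_congr rfl fun s _ => ?_
      congr 1
      exact Fin.ext ((hg s).trans (congrArg (· + (s : ℕ)) h))
    · intro h h'
      rw [e, DKaux.F_lt h (by omega), DKaux.F_gt h' (by omega)]
      simp [DKaux.S]
    · intro h
      rw [← h, hF] at e
      rw [e, DKaux.F_lt (show (a : ℕ) < i by omega) (by omega)]
      simp only [DKaux.S, Finset.sum_singleton, Finset.sum_map]
      refine Finset.sum_congr rfl fun s _ => ?_
      congr 1
      exact Fin.ext ((hg s).trans (congrArg (· + (s : ℕ)) h))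
    · intro h
      rw [e, DKaux.F_lt (show (a : ℕ) < i by omega) (by omega), DKaux.F_lt h (by omega)]
      simp [DKaux.S]
  · apply DKaux.comm_of_t
    intro a b c d
    rw [h₁, h₂]
    have hm : ∀ s, g s ∈ DKaux.F (DKaux.posn (k + l - 1) i l) i := fun s => by
      rw [hF]; exact Finset.mem_map_of_mem _ (Finset.mem_univ _)
    have hm' : ∀ {j : ℕ}, (i : ℕ) ≠ j → ∀ s, g s ∉ DKaux.F (DKaux.posn (k + l - 1) i l) j :=
      fun hj s => Finset.disjoint_left.1 (DKaux.F_disj _ hj) (hm s)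
    have hne : ∀ {a b : Fin k}, a ≠ b → (a : ℕ) ≠ b := fun h h' => h (Fin.ext h')
    rw [← lie_skew, neg_eq_zero]
    split_ifs with hab
    · rw [lie_zero]
    by_cases hia : i = a
    · subst hia
      exact DKaux.t_S_block _ _ _ _ (hm c) (hm d) (DKaux.F_disj _ (hne hab))
    by_cases hib : i = b
    · subst hib
      rw [DKaux.S_symm]
      exact DKaux.t_S_block _ _ _ _ (hm c) (hm d) (DKaux.F_disj _ (hne (Ne.symm hab)))
    exact DKaux.t_S_disj _ _ _ _ (hm' (hne hia) c) (hm' (hne hib) c) (hm' (hne hia) d)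
      (hm' (hne hib) d)
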